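/- A simplicial local k-algebra A with residue field k and maximal simplicial ideal m(A) is levelwise-generated-Artinian in the following sense: if (1) the normalized chain complex of the cotangent space m(A)/m(A)^2 is finite-dimensional (zero in all but finitely many degrees, finite-dimensional in each), and (2) m(A)^n = 0 for some n > 0, then each A_i is an Artinian local k-algebra and A is an Artinian object of the category of simplicial local k-algebras (it satisfies the descending chain condition on simplicial ideals). -/

import Mathlib

/-!
STATEMENT 3: A simplicial local `k`-algebra `A` with residue field `k` satisfying
(1) the normalized chain complex of the cotangent space `m(A)/m(A)²` is
    finite-dimensional (concentrated in finitely many degrees, finite-dimensional in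
    each degree), and
(2) `m(A)^n = 0` for some `n > 0`,
is Artinian: each level `A_i` is an Artinian local `k`-algebra, and `A` satisfies the
descending chain condition on simplicial ideals.
-/

open CategoryTheory IsLocalRing

/-- A simplicial commutative `k`-algebra, as a (contravariant) functor from the simplex
category to `k`-algebras. -/
structure SimpAlg (k : Type) [Field k] where
  obj : SimplexCategoryᵒᵖ → Type
  [ring : ∀ n, CommRing (obj n)]
  [alg : ∀ n, Algebra k (obj n)]
  map : ∀ {m n : SimplexCategoryᵒᵖ}, (m ⟶ n) → (obj m →ₐ[k] obj n)
  map_id : ∀ n, map (𝟙 n) = AlgHom.id k (obj n)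
  map_comp : ∀ {a b c : SimplexCategoryᵒᵖ} (f : a ⟶ b) (g : b ⟶ c),
    map (f ≫ g) = (map g).comp (map f)

attribute [instance] SimpAlg.ring SimpAlg.alg

namespace SimpAlg

variable {k : Type} [Field k] (A : SimpAlg k)

/-- The `n`-th level `A_n`. -/
abbrev lvl (n : ℕ) : Type := A.obj (Opposite.op (SimplexCategory.mk n))

/-- The face map `∂_i : A_{n+1} → A_n`. -/
def face {n : ℕ} (i : Fin (n + 2)) : A.lvl (n + 1) →ₐ[k] A.lvl n :=
  A.map (SimplexCategory.δ i).op

/-- A simplicial ideal of `A`: a family of ideals closed under all simplicial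
structure maps. -/
structure SimpIdeal where
  I : ∀ n : SimplexCategoryᵒᵖ, Ideal (A.obj n)
  compat : ∀ {m n : SimplexCategoryᵒᵖ} (f : m ⟶ n), ∀ x ∈ I m, A.map f x ∈ I n

variable [∀ n, IsLocalRing (A.obj n)]

/-- The degree-`(n+1)` part of the normalized complex of the maximal simplicial ideal:
`N(m(A))_{n+1} = m(A)_{n+1} ∩ ⋂_{i>0} ker ∂_i`, as a `k`-subspace of `A_{n+1}`. -/
def Nm (n : ℕ) : Submodule k (A.lvl (n + 1)) :=
  (Submodule.restrictScalars k (maximalIdeal (A.lvl (n + 1)))) ⊓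
    ⨅ j : Fin (n + 1), LinearMap.ker (A.face j.succ).toLinearMap

/-- The square of the maximal ideal, as a `k`-subspace. -/
def m2 (n : ℕ) : Submodule k (A.lvl n) :=
  Submodule.restrictScalars k (maximalIdeal (A.lvl n) ^ 2)

end SimpAlg

open SimpAlg

namespace SimpAlg

section Identities

variable {k : Type} [Field k] (A : SimpAlg k)

/-- The degeneracy map `s_i : A_n → A_{n+1}`. -/
def degen {n : ℕ} (i : Fin (n + 1)) : A.lvl n →ₐ[k] A.lvl (n + 1) :=
  A.map (SimplexCategory.σ i).op

lemma map_map {a b c : SimplexCategoryᵒᵖ} (f : a ⟶ b) (g : b ⟶ c) (x : A.obj a) :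
    A.map g (A.map f x) = A.map (f ≫ g) x := by
  rw [A.map_comp]; rfl

lemma face_face {n : ℕ} {i j : Fin (n + 2)} (h : i ≤ j) (x : A.lvl (n + 2)) :
    A.face i (A.face j.succ x) = A.face j (A.face i.castSucc x) := by
  simp only [face, map_map, ← op_comp, SimplexCategory.δ_comp_δ h]

lemma face_succ_degen_self {n : ℕ} (i : Fin (n + 1)) (x : A.lvl n) :
    A.face i.succ (A.degen i x) = x := by
  simp only [face, degen, map_map, ← op_comp, SimplexCategory.δ_comp_σ_succ, op_id, A.map_id]
  rfl

lemma face_succ_degen_castSucc {n : ℕ} {i : Fin (n + 1)} {j : Fin (n + 2)}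
    (h : i.castSucc < j) (x : A.lvl (n + 1)) :
    A.face j.succ (A.degen i.castSucc x) = A.degen i (A.face j x) := by
  simp only [face, degen, map_map, ← op_comp, SimplexCategory.δ_comp_σ_of_gt h]

lemma degen_degen {n : ℕ} {i j : Fin (n + 1)} (h : i ≤ j) (x : A.lvl n) :
    A.degen i.castSucc (A.degen j x) = A.degen j.succ (A.degen i x) := by
  simp only [degen, map_map, ← op_comp, SimplexCategory.σ_comp_σ h]

lemma degen_degen_mem_range_succAbove {n : ℕ} (i : Fin (n + 2)) (u : Fin (n + 1))
    (x : A.lvl n) : A.degen i (A.degen u x) ∈ (A.degen (i.succAbove u)).range := by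
  rcases lt_or_ge u.castSucc i with h | h
  · obtain ⟨j, rfl⟩ := Fin.exists_succ_eq.2 (Fin.ne_zero_of_lt h)
    rw [Fin.succAbove_of_castSucc_lt _ _ h, ← A.degen_degen (Fin.castSucc_lt_succ_iff.1 h)]
    exact ⟨_, rfl⟩
  · obtain ⟨j, rfl⟩ := Fin.exists_castSucc_eq.2 (h.trans_lt u.castSucc_lt_last).ne
    rw [Fin.succAbove_of_le_castSucc _ _ h, A.degen_degen (Fin.castSucc_le_castSucc_iff.1 h)]
    exact ⟨_, rfl⟩

end Identities

section Normalization

variable {k : Type} [Field k] {A : SimpAlg k}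

/-- Every element of a simplicial ideal is the sum of a normalized element and of degenerate
elements of the same ideal. -/
lemma SimpIdeal.exists_normalized_add_degenerate (I : A.SimpIdeal) {n : ℕ} {x : A.lvl (n + 1)}
    (hx : x ∈ I.I _) :
    ∃ z : A.lvl (n + 1), z ∈ I.I _ ∧ (∀ j : Fin (n + 1), A.face j.succ z = 0) ∧
      ∃ y : Fin (n + 1) → A.lvl n, (∀ i, y i ∈ I.I _) ∧ x = z + ∑ i, A.degen i (y i) := by
  suffices H : ∀ s t : ℕ, t + s = n + 1 →
      ∃ z : A.lvl (n + 1), z ∈ I.I _ ∧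
        (∀ j : Fin (n + 1), t ≤ j.1 → A.face j.succ z = 0) ∧
        ∃ y : Fin (n + 1) → A.lvl n, (∀ i, y i ∈ I.I _) ∧ x = z + ∑ i, A.degen i (y i) by
    simpa using H (n + 1) 0 (by simp)
  intro s
  induction s with
  | zero =>
    intro t ht
    exact ⟨x, hx, fun j hj => absurd j.2 (by omega), 0, fun i => Ideal.zero_mem _, by simp⟩
  | succ s ih =>
    intro t ht
    obtain ⟨z, hz, hz0, y, hy, hxy⟩ := ih (t + 1) (by omega)
    let T : Fin (n + 1) := ⟨t, by omega⟩
    have hf : A.face T.succ z ∈ I.I _ := I.compat _ _ hz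
    refine ⟨z - A.degen T (A.face T.succ z), Ideal.sub_mem _ hz (I.compat _ _ hf), ?_,
      y + Pi.single T (A.face T.succ z), ?_, ?_⟩
    · intro j hj
      rcases hj.eq_or_lt with h | h
      · obtain rfl : T = j := Fin.ext h
        rw [map_sub, face_succ_degen_self, sub_self]
      · have hT : T < j := h
        rw [map_sub, hz0 j h, zero_sub, neg_eq_zero]
        cases n with
        | zero => exact absurd j.2 (by omega)
        | succ n =>
          obtain ⟨T', hT'⟩ := Fin.exists_castSucc_eq.2 (hT.trans_le j.le_last).ne
          rw [← hT'] at hT ⊢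
          rw [A.face_succ_degen_castSucc hT, Fin.succ_castSucc,
            ← A.face_face (Fin.castSucc_lt_iff_succ_le.1 hT), hz0 j h, map_zero, map_zero]
    · intro i
      by_cases h : i = T
      · subst h; simpa using Ideal.add_mem _ (hy _) hf
      · simpa [h] using hy i
    · have : ∑ i, A.degen i (Pi.single (M := fun _ => A.lvl n) T (A.face T.succ z) i) =
          A.degen T (A.face T.succ z) := by
        rw [Finset.sum_eq_single T (fun i _ h => by simp [h]) (by simp)]
        simp
      simp only [Pi.add_apply, map_add, Finset.sum_add_distrib, this]
      rw [hxy]; ring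

variable (A) in
/-- The span in `A_n` of the images of the degeneracies `s_i` with `i < t`. -/
def degenSpan (t : ℕ) : ∀ n : ℕ, Submodule k (A.lvl n)
  | 0 => ⊥
  | n + 1 => Submodule.span k {x | ∃ i : Fin (n + 1), i.1 < t ∧ ∃ y, A.degen i y = x}

lemma degen_mem_degenSpan {t n : ℕ} {i : Fin (n + 1)} (h : i.1 < t) (y : A.lvl n) :
    A.degen i y ∈ A.degenSpan t (n + 1) :=
  Submodule.subset_span ⟨i, h, y, rfl⟩

lemma face_mem_degenSpan {n : ℕ} (t : Fin (n + 1)) {x : A.lvl (n + 1)}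
    (hx : x ∈ A.degenSpan t (n + 1)) : A.face t.succ x ∈ A.degenSpan t n := by
  induction hx using Submodule.span_induction with
  | mem x hx =>
    obtain ⟨i, hi, y, rfl⟩ := hx
    cases n with
    | zero => exact absurd t.2 (by omega)
    | succ n =>
      have hit : i < t := hi
      obtain ⟨i', rfl⟩ := Fin.exists_castSucc_eq.2 (hit.trans_le t.le_last).ne
      rw [A.face_succ_degen_castSucc hit]
      exact degen_mem_degenSpan (i := i') hi _
  | zero => simp
  | add x y _ _ hx hy => rw [map_add]; exact add_mem hx hy
  | smul c x _ hx => rw [map_smul]; exact Submodule.smul_mem _ _ hx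

lemma degen_mem_degenSpan_of_mem {n : ℕ} (t : Fin (n + 1)) {x : A.lvl n}
    (hx : x ∈ A.degenSpan t n) : A.degen t x ∈ A.degenSpan t (n + 1) := by
  cases n with
  | zero =>
    rw [(Submodule.mem_bot k).1 hx, map_zero]
    exact zero_mem _
  | succ n =>
    induction hx using Submodule.span_induction with
    | mem x hx =>
      obtain ⟨i, hi, y, rfl⟩ := hx
      obtain ⟨t', rfl⟩ := Fin.exists_succ_eq.2 (show t ≠ 0 by rintro rfl; simp at hi)
      rw [← A.degen_degen (show i ≤ t' from Nat.lt_succ_iff.1 hi)]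
      exact degen_mem_degenSpan (i := i.castSucc) hi _
    | zero => simp
    | add x y _ _ hx hy => rw [map_add]; exact add_mem hx hy
    | smul c x _ hx => rw [map_smul]; exact Submodule.smul_mem _ _ hx

lemma mem_degenSpan_succ {n : ℕ} (t : Fin (n + 1)) {x : A.lvl (n + 1)}
    (hx : x ∈ A.degenSpan (t + 1) (n + 1)) :
    ∃ y, ∃ w ∈ A.degenSpan t (n + 1), x = A.degen t y + w := by
  induction hx using Submodule.span_induction with
  | mem x hx =>
    obtain ⟨i, hi, y, rfl⟩ := hx
    rcases (Nat.lt_succ_iff.1 hi).eq_or_lt with h | h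
    · obtain rfl : i = t := Fin.ext h
      exact ⟨y, 0, zero_mem _, by simp⟩
    · exact ⟨0, _, degen_mem_degenSpan h y, by simp⟩
  | zero => exact ⟨0, 0, zero_mem _, by simp⟩
  | add x y _ _ hx hy =>
    obtain ⟨a, v, hv, rfl⟩ := hx
    obtain ⟨b, w, hw, rfl⟩ := hy
    exact ⟨a + b, v + w, add_mem hv hw, by rw [map_add]; abel⟩
  | smul c x _ hx =>
    obtain ⟨a, v, hv, rfl⟩ := hx
    exact ⟨c • a, c • v, Submodule.smul_mem _ _ hv, by rw [map_smul, smul_add]⟩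

/-- A normalized element in the span of the degenerate elements is zero. -/
lemma eq_zero_of_mem_degenSpan {n : ℕ} {x : A.lvl (n + 1)}
    (hx : x ∈ A.degenSpan (n + 1) (n + 1)) (hx0 : ∀ j : Fin (n + 1), A.face j.succ x = 0) :
    x = 0 := by
  have H : x ∈ A.degenSpan 0 (n + 1) := by
    refine Nat.decreasingInduction (motive := fun t _ => x ∈ A.degenSpan t (n + 1))
      (fun t ht h => ?_) hx (Nat.zero_le (n + 1))
    obtain ⟨y, w, hw, rfl⟩ := mem_degenSpan_succ ⟨t, ht⟩ h
    have h0 := hx0 ⟨t, ht⟩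
    rw [map_add, face_succ_degen_self, add_eq_zero_iff_eq_neg] at h0
    refine add_mem (degen_mem_degenSpan_of_mem ⟨t, ht⟩ ?_) hw
    rw [h0]
    exact neg_mem (face_mem_degenSpan _ hw)
  simpa [degenSpan] using H

/-- A simplicial ideal is determined by its levels below a degree from which on there are no
nonzero normalized elements. -/
lemma SimpIdeal.le_of_forall_le {D : ℕ}
    (hD : ∀ n, D ≤ n → ∀ x : A.lvl (n + 1), (∀ j : Fin (n + 1), A.face j.succ x = 0) → x = 0)
    {I J : A.SimpIdeal}
    (h : ∀ n, n ≤ D → I.I (Opposite.op (SimplexCategory.mk n)) ≤ J.I _) (n : ℕ) :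
    I.I (Opposite.op (SimplexCategory.mk n)) ≤ J.I _ := by
  induction n with
  | zero => exact h 0 (Nat.zero_le D)
  | succ n ih =>
    rcases le_or_gt (n + 1) D with hn | hn
    · exact h _ hn
    intro x hx
    obtain ⟨z, -, hz0, y, hy, rfl⟩ := I.exists_normalized_add_degenerate (n := n) (x := x) hx
    rw [hD n (by omega) z hz0, zero_add]
    exact sum_mem fun i _ => J.compat _ _ (ih (hy i))

end Normalization

section Weight

variable {k : Type} [Field k] (A : SimpAlg k)

/-- The span of the elements of `A_{n+1}` which are `s_t`-degenerate for all but at most `w`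
indices `t`. -/
def weightSpan (w n : ℕ) : Submodule k (A.lvl (n + 1)) :=
  Submodule.span k
    {x | ∃ T : Finset (Fin (n + 1)), T.card ≤ w ∧ ∀ t ∉ T, x ∈ (A.degen t).range}

variable {A}

lemma weightSpan_mono {w w' : ℕ} (h : w ≤ w') (n : ℕ) : A.weightSpan w n ≤ A.weightSpan w' n :=
  Submodule.span_mono fun _ ⟨T, hT, hx⟩ => ⟨T, hT.trans h, hx⟩

lemma weightSpan_mul_le (w w' n : ℕ) :
    A.weightSpan w n * A.weightSpan w' n ≤ A.weightSpan (w + w') n := by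
  rw [weightSpan, weightSpan, Submodule.span_mul_span]
  refine Submodule.span_mono ?_
  rintro _ ⟨x, ⟨T, hT, hx⟩, y, ⟨T', hT', hy⟩, rfl⟩
  refine ⟨T ∪ T', (Finset.card_union_le _ _).trans (add_le_add hT hT'), fun t ht => ?_⟩
  rw [Finset.mem_union, not_or] at ht
  exact mul_mem (hx t ht.1) (hy t ht.2)

lemma one_mem_weightSpan (w n : ℕ) : (1 : A.lvl (n + 1)) ∈ A.weightSpan w n :=
  Submodule.subset_span ⟨∅, by simp, fun _ _ => one_mem _⟩

lemma weightSpan_eq_top {w n : ℕ} (h : n + 1 ≤ w) : A.weightSpan w n = ⊤ :=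
  eq_top_iff.2 fun _ _ => Submodule.subset_span ⟨Finset.univ, by simpa using h, by simp⟩

lemma weightSpan_le_degenSpan {w n : ℕ} (h : w < n + 1) :
    A.weightSpan w n ≤ A.degenSpan (n + 1) (n + 1) := by
  refine Submodule.span_le.2 ?_
  rintro x ⟨T, hT, hx⟩
  obtain ⟨t, ht⟩ : ∃ t, t ∉ T := by
    by_contra! hall
    rw [Finset.eq_univ_iff_forall.2 hall, Finset.card_univ, Fintype.card_fin] at hT
    omega
  obtain ⟨y, rfl⟩ := hx t ht
  exact degen_mem_degenSpan t.2 y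

lemma degen_mem_weightSpan {w n : ℕ} (i : Fin (n + 2)) {x : A.lvl (n + 1)}
    (hx : x ∈ A.weightSpan w n) : A.degen i x ∈ A.weightSpan w (n + 1) := by
  induction hx using Submodule.span_induction with
  | mem x hx =>
    obtain ⟨T, hT, hx⟩ := hx
    refine Submodule.subset_span ⟨T.map i.succAboveEmb, by simpa using hT, fun t ht => ?_⟩
    rcases eq_or_ne t i with rfl | hti
    · exact ⟨x, rfl⟩
    · obtain ⟨u, rfl⟩ := Fin.exists_succAbove_eq hti
      obtain ⟨y, rfl⟩ := hx u fun hu => ht (Finset.mem_map.2 ⟨u, hu, rfl⟩)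
      exact A.degen_degen_mem_range_succAbove i u y
  | zero => simp
  | add x y _ _ hx hy => rw [map_add]; exact add_mem hx hy
  | smul c x _ hx => rw [map_smul]; exact Submodule.smul_mem _ _ hx

end Weight

section Local

variable {k : Type} [Field k] {A : SimpAlg k} [∀ n, IsLocalRing (A.obj n)]

variable (A) in
/-- The maximal simplicial ideal, when all levels have nilpotent maximal ideal. -/
def maxIdeal (h : ∀ n, IsNilpotent (maximalIdeal (A.obj n))) : A.SimpIdeal where
  I n := maximalIdeal (A.obj n)
  compat {m n} f x hx := by
    obtain ⟨N, hN⟩ := h m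
    have hx0 : x ^ N = 0 := by
      have := Ideal.pow_mem_pow hx N
      rwa [hN] at this
    have : IsNilpotent (A.map f x) := ⟨N, by rw [← map_pow, hx0, map_zero]⟩
    exact fun hu => this.not_isUnit hu

lemma mem_Nm {n : ℕ} {x : A.lvl (n + 1)} :
    x ∈ A.Nm n ↔ x ∈ maximalIdeal (A.lvl (n + 1)) ∧ ∀ j : Fin (n + 1), A.face j.succ x = 0 := by
  simp [Nm]

lemma maximalIdeal_le_weightSpan_sup (h : ∀ n, IsNilpotent (maximalIdeal (A.obj n))) {d : ℕ}
    (hd : ∀ n, d ≤ n + 1 → A.Nm (n + 1) ≤ A.m2 (n + 2)) (hd0 : 0 < d) (n : ℕ) :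
    (maximalIdeal (A.lvl (n + 1))).restrictScalars k ≤ A.weightSpan d n ⊔ A.m2 (n + 1) := by
  induction n with
  | zero => rw [weightSpan_eq_top (by omega), top_sup_eq]; exact le_top
  | succ n ih =>
    rcases le_or_gt (n + 2) d with hn | hn
    · rw [weightSpan_eq_top hn, top_sup_eq]; exact le_top
    intro x hx
    obtain ⟨z, hz, hz0, y, hy, rfl⟩ :=
      (A.maxIdeal h).exists_normalized_add_degenerate (n := n + 1) (x := x) hx
    refine add_mem (Submodule.mem_sup_right (hd n (by omega) (mem_Nm.2 ⟨hz, hz0⟩)))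
      (sum_mem fun i _ => ?_)
    obtain ⟨a, ha, b, hb, hab⟩ := Submodule.mem_sup.1 (ih (hy i))
    rw [← hab, map_add]
    refine add_mem (Submodule.mem_sup_left (degen_mem_weightSpan i ha))
      (Submodule.mem_sup_right ?_)
    have hmap : (maximalIdeal (A.lvl (n + 1))).map (A.degen i) ≤ maximalIdeal (A.lvl (n + 2)) :=
      Ideal.map_le_iff_le_comap.2 fun u hu => (A.maxIdeal h).compat _ u hu
    have := Ideal.mem_map_of_mem (A.degen i) hb
    rw [Ideal.map_pow] at this
    exact Ideal.pow_right_mono hmap 2 this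

end Local

end SimpAlg

/-- If `M` is generated modulo `M ^ 2` by `W ≤ M`, then `M ^ i` is generated modulo `M ^ (i + 1)`
by `W ^ i`. -/
lemma Submodule.pow_le_pow_sup_pow_succ {R S : Type*} [CommSemiring R] [CommSemiring S]
    [Algebra R S] {M W : Submodule R S} (hWM : W ≤ M) (h : M ≤ W ⊔ M ^ 2) (i : ℕ) :
    M ^ (i + 1) ≤ W ^ (i + 1) ⊔ M ^ (i + 2) := by
  induction i with
  | zero => simpa using h
  | succ i ih =>
    calc M ^ (i + 2) = M ^ (i + 1) * M := pow_succ _ _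
      _ ≤ M ^ (i + 1) * (W ⊔ M ^ 2) := mul_le_mul' le_rfl h
      _ = M ^ (i + 1) * W ⊔ M ^ (i + 3) := by rw [Submodule.mul_sup, ← pow_add]
      _ ≤ (W ^ (i + 1) ⊔ M ^ (i + 2)) * W ⊔ M ^ (i + 3) :=
        sup_le_sup_right (mul_le_mul' ih le_rfl) _
      _ = W ^ (i + 2) ⊔ (M ^ (i + 2) * W ⊔ M ^ (i + 3)) := by
        rw [Submodule.sup_mul, ← pow_succ, sup_assoc]
      _ ≤ W ^ (i + 2) ⊔ M ^ (i + 3) := by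
        refine sup_le_sup_left (sup_le ?_ le_rfl) _
        rw [pow_succ M (i + 2)]
        exact mul_le_mul' le_rfl hWM

/-- A nilpotent ideal `I` generated modulo `I ^ 2` by `J` is contained in `J`. -/
lemma Ideal.le_of_le_sup_sq_of_isNilpotent {R : Type*} [CommRing R] {I J : Ideal R}
    (hI : IsNilpotent I) (h : I ≤ J ⊔ I ^ 2) : I ≤ J := by
  have H : ∀ i, I ≤ J ⊔ I ^ (i + 1) := by
    intro i
    induction i with
    | zero => simp
    | succ i ih =>
      refine h.trans (sup_le le_sup_left ?_)
      calc I ^ 2 = I * I := sq I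
        _ ≤ (J ⊔ I ^ (i + 1)) * I := Ideal.mul_mono_left ih
        _ = J * I ⊔ I ^ (i + 2) := by rw [Ideal.sup_mul, ← pow_succ]
        _ ≤ J ⊔ I ^ (i + 2) := sup_le_sup_right Ideal.mul_le_left _
  obtain ⟨N, hN⟩ := hI
  simpa [pow_succ, hN] using H N

/-- A local ring with finitely generated nilpotent maximal ideal is Artinian. -/
lemma IsLocalRing.isArtinianRing_of_fg_of_isNilpotent {R : Type*} [CommRing R] [IsLocalRing R]
    (hfg : (maximalIdeal R).FG) (hnil : IsNilpotent (maximalIdeal R)) : IsArtinianRing R := by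
  have : IsNoetherianRing R := IsNoetherianRing.of_prime fun P hP => by
    obtain ⟨N, hN⟩ := hnil
    have : maximalIdeal R ≤ P := hP.le_of_pow_le (n := N) (by rw [hN]; exact bot_le)
    rwa [← le_antisymm this (le_maximalIdeal hP.ne_top)]
  exact (isArtinianRing_iff_isNilpotent_maximalIdeal R).2 hnil

/-- If `N / (N ∩ P)` is finite-dimensional then `N` is finitely generated modulo `P`. -/
lemma Submodule.exists_fg_le_sup {K V : Type*} [Field K] [AddCommGroup V] [Module K V]
    (N P : Submodule K V) [FiniteDimensional K (N ⧸ P.comap N.subtype)] :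
    ∃ W : Submodule K V, W.FG ∧ W ≤ N ∧ N ≤ W ⊔ P := by
  obtain ⟨C, hC⟩ := (P.comap N.subtype).exists_isCompl
  have : Module.Finite K C :=
    Module.Finite.equiv (Submodule.quotientEquivOfIsCompl _ _ hC)
  refine ⟨C.map N.subtype, (Module.Finite.iff_fg.1 this).map _, Submodule.map_subtype_le _ _, ?_⟩
  intro x hx
  obtain ⟨p, hp, c, hc, hpc⟩ :=
    Submodule.mem_sup.1 (hC.sup_eq_top.ge (Submodule.mem_top (x := (⟨x, hx⟩ : N))))
  rw [show x = (c : V) + (p : V) by rw [add_comm]; exact (congrArg Subtype.val hpc).symm]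
  exact add_mem (mem_sup_left ⟨c, hc, rfl⟩) (mem_sup_right hp)

namespace SimpAlg

section Finiteness

variable {k : Type} [Field k] {A : SimpAlg k} [∀ n, IsLocalRing (A.obj n)]

lemma maximalIdeal_fg (h : ∀ n, IsNilpotent (maximalIdeal (A.obj n)))
    (hfd0 : FiniteDimensional k
      ((Submodule.restrictScalars k (maximalIdeal (A.lvl 0))) ⧸
        (Submodule.comap (Submodule.restrictScalars k (maximalIdeal (A.lvl 0))).subtype (A.m2 0))))
    (hfd : ∀ n, FiniteDimensional k
      ((A.Nm n) ⧸ (Submodule.comap (A.Nm n).subtype (A.m2 (n + 1))))) (n : ℕ) :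
    (maximalIdeal (A.lvl n)).FG := by
  induction n with
  | zero =>
    obtain ⟨W, ⟨S, rfl⟩, hWm, hW⟩ := Submodule.exists_fg_le_sup
      (Submodule.restrictScalars k (maximalIdeal (A.lvl 0))) (A.m2 0)
    refine ⟨S, le_antisymm (Ideal.span_le.2 fun s hs => hWm (Submodule.subset_span hs)) ?_⟩
    refine Ideal.le_of_le_sup_sq_of_isNilpotent (h _) fun x hx => ?_
    obtain ⟨a, ha, b, hb, rfl⟩ := Submodule.mem_sup.1 (hW hx)
    exact add_mem (Ideal.mem_sup_left (Submodule.span_le_restrictScalars k (A.lvl 0) _ ha))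
      (Ideal.mem_sup_right hb)
  | succ n ih =>
    have := hfd n
    obtain ⟨W, ⟨S, rfl⟩, hWm, hW⟩ := Submodule.exists_fg_le_sup (A.Nm n) (A.m2 (n + 1))
    have key : maximalIdeal (A.lvl (n + 1)) =
        Ideal.span S ⊔ ⨆ i : Fin (n + 1), (maximalIdeal (A.lvl n)).map (A.degen i) := by
      refine le_antisymm (Ideal.le_of_le_sup_sq_of_isNilpotent (h _) fun x hx => ?_)
        (sup_le (Ideal.span_le.2 fun s hs => (mem_Nm.1 (hWm (Submodule.subset_span hs))).1)
          (iSup_le fun i => Ideal.map_le_iff_le_comap.2 fun u hu =>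
            (A.maxIdeal h).compat _ u hu))
      obtain ⟨z, hz, hz0, y, hy, rfl⟩ :=
        (A.maxIdeal h).exists_normalized_add_degenerate (n := n) (x := x) hx
      obtain ⟨a, ha, b, hb, rfl⟩ := Submodule.mem_sup.1 (hW (mem_Nm.2 ⟨hz, hz0⟩))
      refine add_mem (add_mem ?_ (Ideal.mem_sup_right hb)) (sum_mem fun i _ => ?_)
      · exact Ideal.mem_sup_left (Ideal.mem_sup_left
          (Submodule.span_le_restrictScalars k (A.lvl (n + 1)) _ ha))
      · exact Ideal.mem_sup_left (Ideal.mem_sup_right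
          (Ideal.mem_iSup_of_mem i (Ideal.mem_map_of_mem _ (hy i))))
    rw [key]
    exact Submodule.FG.sup ⟨S, rfl⟩ (Submodule.fg_iSup _ fun i => ih.map _)

/-- In high degrees there are no nonzero normalized elements. -/
lemma eq_zero_of_normalized
    (hres : ∀ n, Function.Surjective ((residue (A.obj n)).comp (algebraMap k (A.obj n))))
    {d N : ℕ} (hN : ∀ n, maximalIdeal (A.obj n) ^ N = ⊥)
    (hd : ∀ n, d ≤ n + 1 → A.Nm (n + 1) ≤ A.m2 (n + 2)) (hd0 : 0 < d) {n : ℕ}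
    (hn : N * d ≤ n) {x : A.lvl (n + 1)} (hx : ∀ j : Fin (n + 1), A.face j.succ x = 0) :
    x = 0 := by
  refine eq_zero_of_mem_degenSpan (weightSpan_le_degenSpan (Nat.lt_succ_of_le hn) ?_) hx
  set M := (maximalIdeal (A.lvl (n + 1))).restrictScalars k with hM
  have hMpow (i : ℕ) : M ^ (i + 1) = ((maximalIdeal (A.lvl (n + 1))) ^ (i + 1)).restrictScalars k :=
    (Submodule.restrictScalars_pow (Nat.succ_ne_zero i)).symm
  set W := A.weightSpan d n ⊓ M with hW
  have hWM : M ≤ W ⊔ M ^ 2 := by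
    intro u hu
    obtain ⟨a, ha, b, hb, rfl⟩ :=
      Submodule.mem_sup.1 (maximalIdeal_le_weightSpan_sup (fun n => ⟨N, hN n⟩) hd hd0 n hu)
    have hbM : b ∈ M := Ideal.pow_le_self two_ne_zero hb
    refine add_mem (Submodule.mem_sup_left ⟨ha, ?_⟩) (Submodule.mem_sup_right ?_)
    · simpa using sub_mem hu hbM
    · rw [hMpow 1]; exact hb
  have hWpow (i : ℕ) : W ^ i ≤ A.weightSpan (i * d) n := by
    induction i with
    | zero => rw [pow_zero, Submodule.one_le]; exact one_mem_weightSpan _ _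
    | succ i ih =>
      rw [pow_succ, Nat.succ_mul]
      exact (mul_le_mul' ih inf_le_left).trans (weightSpan_mul_le _ _ _)
  have hMi (i : ℕ) : M ≤ A.weightSpan (i * d) n ⊔ M ^ (i + 1) := by
    induction i with
    | zero => simp
    | succ i ih =>
      refine ih.trans (sup_le (le_sup_of_le_left (weightSpan_mono (by gcongr; omega) n)) ?_)
      exact (Submodule.pow_le_pow_sup_pow_succ inf_le_right hWM i).trans
        (sup_le_sup_right (hWpow _) _)
  have hMN : M ≤ A.weightSpan (N * d) n := by
    refine (hMi N).trans (sup_le le_rfl ?_)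
    rw [hMpow, pow_succ, hN, Ideal.bot_mul]
    exact bot_le
  obtain ⟨c, hc⟩ := hres _ (residue _ x)
  have hxc : x - algebraMap k _ c ∈ M := by
    rw [hM, Submodule.restrictScalars_mem, ← residue_eq_zero_iff, map_sub, ← hc]
    exact sub_self _
  rw [← sub_add_cancel x (algebraMap k _ c), Algebra.algebraMap_eq_smul_one]
  refine add_mem ?_ (Submodule.smul_mem _ _ (one_mem_weightSpan _ _))
  rw [← Algebra.algebraMap_eq_smul_one]
  exact hMN hxc

end Finiteness

end SimpAlg

theorem simplicial_algebra_artinian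
    {k : Type} [Field k] (A : SimpAlg k)
    [∀ n, IsLocalRing (A.obj n)]
    (hres : ∀ n, Function.Bijective ((residue (A.obj n)).comp (algebraMap k (A.obj n))))
    -- (1) the normalized cotangent complex `N(m(A)/m(A)²)` is finite-dimensional:
    (hfd0 : FiniteDimensional k
      ((Submodule.restrictScalars k (maximalIdeal (A.lvl 0))) ⧸
        (Submodule.comap (Submodule.restrictScalars k (maximalIdeal (A.lvl 0))).subtype (A.m2 0))))
    (hfd : ∀ n, FiniteDimensional k
      ((A.Nm n) ⧸ (Submodule.comap (A.Nm n).subtype (A.m2 (n + 1)))))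
    (hconc : ∃ N : ℕ, ∀ n, N ≤ n → A.Nm n ≤ A.m2 (n + 1))
    -- (2) `m(A)^n = 0` for some `n > 0`:
    (hnilp : ∃ N : ℕ, 0 < N ∧ ∀ n, maximalIdeal (A.obj n) ^ N = ⊥) :
    -- each level is an Artinian local `k`-algebra, and `A` is an Artinian object of the
    -- category of simplicial local `k`-algebras:
    (∀ n, IsArtinianRing (A.obj n))
    ∧
    (∀ c : ℕ → A.SimpIdeal,
      (∀ (j : ℕ) (n : SimplexCategoryᵒᵖ), (c (j + 1)).I n ≤ (c j).I n) →
      ∃ N : ℕ, ∀ j, N ≤ j → ∀ n, (c j).I n = (c N).I n) := by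
  obtain ⟨N, -, hN⟩ := hnilp
  obtain ⟨d, hd⟩ := hconc
  have hnil (n) : IsNilpotent (maximalIdeal (A.obj n)) := ⟨N, hN n⟩
  have hart (n : SimplexCategoryᵒᵖ) : IsArtinianRing (A.obj n) :=
    isArtinianRing_of_fg_of_isNilpotent (maximalIdeal_fg hnil hfd0 hfd n.unop.len) (hnil n)
  refine ⟨hart, fun c hc => ?_⟩
  have hanti (n : SimplexCategoryᵒᵖ) : Antitone fun j => (c j).I n :=
    antitone_nat_of_succ_le fun j => hc j n
  have hstab (n : SimplexCategoryᵒᵖ) : ∃ K, ∀ j, K ≤ j → (c K).I n = (c j).I n :=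
    IsArtinian.monotone_stabilizes ⟨fun j => OrderDual.toDual ((c j).I n), hanti n⟩
  choose K hK using hstab
  let D := N * (d + 1)
  refine ⟨(Finset.range (D + 1)).sup fun n => K (Opposite.op (SimplexCategory.mk n)),
    fun j hj n => le_antisymm (hanti n hj) ?_⟩
  refine SimpIdeal.le_of_forall_le (D := D) (fun m hm x hx => ?_) (fun m hm => ?_) n.unop.len
  · exact eq_zero_of_normalized (fun n => (hres n).2) hN (fun n hn => hd _ (by omega))
      d.succ_pos hm hx
  · have hKm := Finset.le_sup (f := fun n => K (Opposite.op (SimplexCategory.mk n)))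
      (Finset.mem_range.2 (Nat.lt_succ_of_le hm))
    rw [← hK _ _ hKm, ← hK _ _ (hKm.trans hj)]
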